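/- Let G be a finite simple undirected graph with adjacency matrix A, vertex degrees k_i, and m ≥ 1 edges, and let the vertices be partitioned into communities c_1,…,c_p. Then the modularity Q = (1/(2m)) Σ_{i,j} (A_{ij} − k_i k_j/(2m)) δ(c_i, c_j) satisfies −1/2 ≤ Q ≤ 1. -/

import Mathlib

open Finset Matrix

/-- For a nonnegative symmetric weight matrix, the squared volume of a vertex set `s` is controlled
by the total weight and the weight inside `s`. -/
lemma sq_volume_le {ι : Type*} [Fintype ι] [DecidableEq ι] (A : Matrix ι ι ℝ) (hA : A = Aᵀ)
    (h0 : ∀ i j, 0 ≤ A i j) (s : Finset ι) :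
    (∑ i ∈ s, ∑ j, A i j) ^ 2 ≤ (∑ i, ∑ j, A i j) * (∑ i ∈ s, ∑ j ∈ s, A i j) +
      (∑ i, ∑ j, A i j) / 2 * ∑ i ∈ s, ∑ j, A i j := by
  have hsym : ∑ i ∈ sᶜ, ∑ j ∈ s, A i j = ∑ i ∈ s, ∑ j ∈ sᶜ, A i j :=
    sum_comm.trans <| sum_congr rfl fun i _ => sum_congr rfl fun j _ =>
      congrFun (congrFun hA j) i
  have hvol : ∑ i ∈ s, ∑ j, A i j = ∑ i ∈ s, ∑ j ∈ s, A i j + ∑ i ∈ s, ∑ j ∈ sᶜ, A i j := by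
    simp_rw [← sum_add_sum_compl s (A _), sum_add_distrib]
  have htot : ∑ i, ∑ j, A i j = ∑ i ∈ s, ∑ j, A i j +
      (∑ i ∈ sᶜ, ∑ j ∈ s, A i j + ∑ i ∈ sᶜ, ∑ j ∈ sᶜ, A i j) := by
    rw [← sum_add_sum_compl s]
    congr 1
    simp_rw [← sum_add_sum_compl s (A _), sum_add_distrib]
  have hin : 0 ≤ ∑ i ∈ s, ∑ j ∈ s, A i j := sum_nonneg fun i _ => sum_nonneg fun j _ => h0 i j
  have hcut : 0 ≤ ∑ i ∈ s, ∑ j ∈ sᶜ, A i j := sum_nonneg fun i _ => sum_nonneg fun j _ => h0 i j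
  have hout : 0 ≤ ∑ i ∈ sᶜ, ∑ j ∈ sᶜ, A i j := sum_nonneg fun i _ => sum_nonneg fun j _ => h0 i j
  rw [htot, hsym, hvol]
  generalize ∑ i ∈ s, ∑ j ∈ s, A i j = w at *
  generalize ∑ i ∈ s, ∑ j ∈ sᶜ, A i j = b at *
  generalize ∑ i ∈ sᶜ, ∑ j ∈ sᶜ, A i j = r at *
  nlinarith [mul_nonneg hin hcut, mul_nonneg hin hout, mul_nonneg hcut hout, mul_nonneg hin hin]

/-- A double sum restricted to pairs in the same class splits over the classes. -/
lemma sum_sum_mul_ite_eq_sum_fiber {ι κ : Type*} [Fintype ι] [Fintype κ] [DecidableEq κ]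
    (c : ι → κ) (f : ι → ι → ℝ) :
    ∑ i, ∑ j, f i j * (if c i = c j then (1 : ℝ) else 0) =
      ∑ d, ∑ i with c i = d, ∑ j with c j = d, f i j := by
  rw [← sum_fiberwise univ c]
  refine sum_congr rfl fun d _ => sum_congr rfl fun i hi => ?_
  rw [(mem_filter.mp hi).2, sum_filter]
  simp [eq_comm]

/-- The modularity of any partition of the vertices of a finite simple
undirected graph (with `m ≥ 1` edges) into communities lies in `[−1/2, 1]`. -/
theorem modularity_bounds {n p : ℕ}
    (A : Matrix (Fin n) (Fin n) ℝ)
    (hsymm : A = Aᵀ) (hdiag : ∀ i, A i i = 0)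
    (h01 : ∀ i j, A i j = 0 ∨ A i j = 1)
    (k : Fin n → ℝ) (hk : ∀ i, k i = ∑ j, A i j)
    (m : ℕ) (hm : 1 ≤ m) (hmA : (m : ℝ) = (∑ i, ∑ j, A i j) / 2)
    (c : Fin n → Fin p)
    (Q : ℝ)
    (hQ : Q = (1 / (2 * (m : ℝ))) *
      ∑ i, ∑ j, (A i j - k i * k j / (2 * (m : ℝ))) *
        (if c i = c j then (1 : ℝ) else 0)) :
    -(1 / 2) ≤ Q ∧ Q ≤ 1 := by
  have h0 : ∀ i j, 0 ≤ A i j := fun i j => by rcases h01 i j with h | h <;> simp [h]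
  obtain ⟨M, hM⟩ : ∃ M : ℝ, M = 2 * (m : ℝ) := ⟨_, rfl⟩
  have hMpos : 0 < M := by
    have : (1 : ℝ) ≤ m := by exact_mod_cast hm
    linarith
  have hMA : ∑ i, ∑ j, A i j = M := by linarith
  have hsplit : ∑ i, ∑ j, (A i j - k i * k j / M) * (if c i = c j then (1 : ℝ) else 0) =
      ∑ d, ∑ i with c i = d, ∑ j with c j = d, A i j -
        (∑ d, (∑ i with c i = d, k i) ^ 2) / M := by
    rw [sum_sum_mul_ite_eq_sum_fiber, sum_div, ← sum_sub_distrib]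
    refine sum_congr rfl fun d _ => ?_
    simp_rw [sum_sub_distrib, sq, sum_mul_sum, sum_div]
  have hvol : ∑ d, ∑ i with c i = d, k i = M := by
    rw [sum_fiberwise, ← hMA]
    exact sum_congr rfl fun i _ => hk i
  have hlower : ∑ d, (∑ i with c i = d, k i) ^ 2 ≤
      M * ∑ d, ∑ i with c i = d, ∑ j with c j = d, A i j + M / 2 * M := by
    nth_rw 3 [← hvol]
    rw [mul_sum, mul_sum, ← sum_add_distrib]
    refine sum_le_sum fun d _ => ?_
    simpa only [hk, hMA] using sq_volume_le A hsymm h0 {i | c i = d}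
  have hsq : 0 ≤ ∑ d, (∑ i with c i = d, k i) ^ 2 := sum_nonneg fun d _ => sq_nonneg _
  have hupper : ∑ d, ∑ i with c i = d, ∑ j with c j = d, A i j ≤ M := by
    rw [← hMA, ← sum_fiberwise univ c]
    exact sum_le_sum fun d _ => sum_le_sum fun i _ =>
      sum_le_sum_of_subset_of_nonneg (subset_univ _) fun j _ _ => h0 i j
  rw [← hM, hsplit] at hQ
  generalize ∑ d, ∑ i with c i = d, ∑ j with c j = d, A i j = W at *
  generalize ∑ d, (∑ i with c i = d, k i) ^ 2 = S at *
  have hS : 0 ≤ S / M := by positivity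
  have hS' : S / M ≤ W + M / 2 := by
    rw [div_le_iff₀ hMpos]
    linarith
  rw [hQ, one_div_mul_eq_div]
  constructor
  · rw [le_div_iff₀ hMpos]
    linarith
  · rw [div_le_one hMpos]
    linarith
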